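/- Let Γ be a group and let α, β ∈ Γ be distinct. Suppose (𝔾, s, t) ∈ 𝒟, 𝔾 = (G⃗, ψ) is not balanced, every arc of G⃗ incident to s leaves s, and 𝔾 is (s,t)-equivalent to a Γ-labeled graph 𝔾' = (G⃗, ψ') such that ψ'(e⃗) ∈ {α, β} for every arc e⃗ incident to s and ψ'(e⃗) = 1_Γ for every other arc. Then l(𝔾; s, t) = {α, β}. -/

import Mathlib

/-- A Γ-labeled graph: a finite loopless directed multigraph with arcs labeled by
elements of a group Γ.  An arc is represented as a triple `(tail, head, label)`. -/
structure LGraph (V : Type) (Γ : Type) [Group Γ] where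
  verts : Set V
  arcs : Set (V × V × Γ)
  verts_finite : verts.Finite
  arcs_finite : arcs.Finite
  tail_mem : ∀ a ∈ arcs, a.1 ∈ verts
  head_mem : ∀ a ∈ arcs, a.2.1 ∈ verts
  loopless : ∀ a ∈ arcs, a.1 ≠ a.2.1

namespace LGraph

variable {V : Type} {Γ : Type} [Group Γ]

/-- `connects a u v` : the arc `a` joins `u` and `v` (traversed from `u` to `v`,
in either direction of the arc). -/
def connects (a : V × V × Γ) (u v : V) : Prop :=
  (a.1 = u ∧ a.2.1 = v) ∨ (a.1 = v ∧ a.2.1 = u)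

/-- Walks in the underlying undirected graph of a Γ-labeled graph. -/
inductive Walk (G : LGraph V Γ) : V → V → Type
  | nil (v : V) : Walk G v v
  | cons (u v : V) {w : V} (a : V × V × Γ) (ha : a ∈ G.arcs)
      (hstep : connects a u v) (W : Walk G v w) : Walk G u w

variable [DecidableEq V]

/-- `ψ_𝔾(e, v)` : the label contributed by arc `a` when traversed arriving at `v` :
the arc's label if the arc enters `v`, its inverse if it leaves `v`. -/
def stepLabel (v : V) (a : V × V × Γ) : Γ :=
  if a.2.1 = v then a.2.2 else a.2.2⁻¹

namespace Walk

variable {G : LGraph V Γ}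

/-- The label `ψ_𝔾(W)` of a walk: the product of the step labels, later steps
multiplied on the left. -/
def label : {u w : V} → G.Walk u w → Γ
  | _, _, .nil _ => 1
  | _, _, .cons _ v a _ _ W => label W * stepLabel v a

/-- The list of vertices of a walk, in order. -/
def support : {u w : V} → G.Walk u w → List V
  | _, _, .nil v => [v]
  | _, _, .cons u _ _ _ _ W => u :: support W

/-- The list of traversed arcs of a walk, in order. -/
def arcsList : {u w : V} → G.Walk u w → List (V × V × Γ)
  | _, _, .nil _ => []
  | _, _, .cons _ _ a _ _ W => a :: arcsList W

/-- The length (number of edges) of a walk. -/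
def length : {u w : V} → G.Walk u w → ℕ
  | _, _, .nil _ => 0
  | _, _, .cons _ _ _ _ _ W => length W + 1

/-- A walk is a path if all its vertices are distinct. -/
def IsPath {u w : V} (W : G.Walk u w) : Prop := W.support.Nodup

/-- A closed walk is a cycle if it is nonempty, its edges are distinct and its
vertices (except for the repeated end vertex) are distinct. -/
def IsCycle {v : V} (W : G.Walk v v) : Prop :=
  1 ≤ W.length ∧ W.arcsList.Nodup ∧ W.support.dropLast.Nodup

end Walk

/-- `l(𝔾; s, t)` : the set of all labels of s–t paths in `G`. -/
def labelSet (G : LGraph V Γ) (s t : V) : Set Γ :=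
  {γ | ∃ P : G.Walk s t, P.IsPath ∧ P.label = γ}

/-- A Γ-labeled graph is balanced if every cycle has label `1`. -/
def Balanced (G : LGraph V Γ) : Prop :=
  ∀ (v : V) (C : G.Walk v v), C.IsCycle → C.label = 1

/-- Connectivity of (the underlying graph of) a Γ-labeled graph. -/
def Connected (G : LGraph V Γ) : Prop :=
  ∀ u ∈ G.verts, ∀ w ∈ G.verts, Nonempty (G.Walk u w)

/-- `G` has no pair of equivalent arcs: no two distinct arcs that are parallel with
the same label, or antiparallel with mutually inverse labels. -/
def NoEquivArcs (G : LGraph V Γ) : Prop :=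
  ∀ a ∈ G.arcs, ∀ b ∈ G.arcs, a ≠ b →
    ¬ ((a.1 = b.1 ∧ a.2.1 = b.2.1 ∧ a.2.2 = b.2.2) ∨
       (a.1 = b.2.1 ∧ a.2.1 = b.1 ∧ a.2.2 = b.2.2⁻¹))

/-- `(𝔾, s, t) ∈ 𝒟` : `s, t` are distinct vertices, every vertex lies on some
s–t path, and there are no equivalent arcs. -/
def MemD (G : LGraph V Γ) (s t : V) : Prop :=
  s ≠ t ∧ s ∈ G.verts ∧ t ∈ G.verts ∧
  (∀ v ∈ G.verts, ∃ P : G.Walk s t, P.IsPath ∧ v ∈ P.support) ∧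
  G.NoEquivArcs

/-- `(s,t)`-equivalence: `H` is obtained from `G` by shifting by `φ v` at each
vertex `v`, where `φ` vanishes at `s` and `t`. -/
def STEquiv (s t : V) (G H : LGraph V Γ) : Prop :=
  ∃ φ : V → Γ, φ s = 1 ∧ φ t = 1 ∧ H.verts = G.verts ∧
    H.arcs = (fun a : V × V × Γ => (a.1, a.2.1, φ a.2.1 * a.2.2 * (φ a.1)⁻¹)) '' G.arcs

/-- The subgraph induced by a vertex set `X`. -/
def induce (G : LGraph V Γ) (X : Set V) : LGraph V Γ where
  verts := G.verts ∩ X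
  arcs := {a ∈ G.arcs | a.1 ∈ X ∧ a.2.1 ∈ X}
  verts_finite := G.verts_finite.subset Set.inter_subset_left
  arcs_finite := G.arcs_finite.subset fun _ ha => ha.1
  tail_mem := fun a ha => ⟨G.tail_mem a ha.1, ha.2.1⟩
  head_mem := fun a ha => ⟨G.head_mem a ha.1, ha.2.2⟩
  loopless := fun a ha => G.loopless a ha.1

/-- `𝔾 − Y` : deletion of the vertex set `Y`. -/
def delete (G : LGraph V Γ) (Y : Set V) : LGraph V Γ := G.induce Yᶜ

/-- `N_𝔾(X)` : the set of vertices outside `X` adjacent to `X`. -/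
def nbhd (G : LGraph V Γ) (X : Set V) : Set V :=
  {y | y ∉ X ∧ ∃ x ∈ X, ∃ a ∈ G.arcs, connects a x y}

/-- `𝔾⟦X⟧` : the subgraph induced by `X ∪ N(X)` with the edges inside `N(X)` removed. -/
def around (G : LGraph V Γ) (X : Set V) : LGraph V Γ where
  verts := G.verts ∩ (X ∪ G.nbhd X)
  arcs := {a ∈ G.arcs | (a.1 ∈ X ∪ G.nbhd X) ∧ (a.2.1 ∈ X ∪ G.nbhd X) ∧
            ¬ (a.1 ∈ G.nbhd X ∧ a.2.1 ∈ G.nbhd X)}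
  verts_finite := G.verts_finite.subset Set.inter_subset_left
  arcs_finite := G.arcs_finite.subset fun _ ha => ha.1
  tail_mem := fun a ha => ⟨G.tail_mem a ha.1, ha.2.1⟩
  head_mem := fun a ha => ⟨G.head_mem a ha.1, ha.2.2.1⟩
  loopless := fun a ha => G.loopless a ha.1

/-- The arcs of `G` surviving the removal of the vertex set `X`. -/
def keptArcs (G : LGraph V Γ) (X : Set V) : Set (V × V × Γ) :=
  {a ∈ G.arcs | a.1 ∉ X ∧ a.2.1 ∉ X}

/-- `A` contains an arc equivalent to an arc from `x` to `y` with label `γ`. -/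
def hasEquivArc (A : Set (V × V × Γ)) (x y : V) (γ : Γ) : Prop :=
  (x, y, γ) ∈ A ∨ (y, x, γ⁻¹) ∈ A

/-- The new arcs added by a contraction of `X`, between `x` and `y`: an arc from `x`
to `y` with label `γ` for each `γ ∈ l(𝔾⟦X⟧; x, y)`, unless an equivalent arc
already exists among the kept arcs. -/
def newContractionArcs (G : LGraph V Γ) (X : Set V) (x y : V) : Set (V × V × Γ) :=
  {p | ∃ γ ∈ labelSet (G.around X) x y, p = (x, y, γ) ∧ ¬ hasEquivArc (G.keptArcs X) x y γ}

/-- The arc set of the 2-contraction `𝔾 /₂ X`, where `N_𝔾(X) = {x, y}`. -/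
def contract2Arcs (G : LGraph V Γ) (X : Set V) (x y : V) : Set (V × V × Γ) :=
  G.keptArcs X ∪ G.newContractionArcs X x y

/-- The arc set of the 3-contraction `𝔾 /₃ X`, where `N_𝔾(X) = {x, y, z}`. -/
def contract3Arcs (G : LGraph V Γ) (X : Set V) (x y z : V) : Set (V × V × Γ) :=
  G.keptArcs X ∪ G.newContractionArcs X x y ∪ G.newContractionArcs X y z ∪
    G.newContractionArcs X x z

/-- `X` is 2-contractible in `𝔾` (w.r.t. the terminals `s, t`). -/
def TwoContractible (G : LGraph V Γ) (s t : V) (X : Set V) : Prop :=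
  X ⊆ G.verts \ {s, t} ∧
  (∃ x y : V, x ≠ y ∧ G.nbhd X = {x, y}) ∧
  (G.around X).Connected ∧ G.around X ≠ G

/-- `X` is 3-contractible in `𝔾` (w.r.t. the terminals `s, t`). -/
def ThreeContractible (G : LGraph V Γ) (s t : V) (X : Set V) : Prop :=
  X ⊆ G.verts \ {s, t} ∧
  (∃ x y z : V, x ≠ y ∧ x ≠ z ∧ y ≠ z ∧ G.nbhd X = {x, y, z}) ∧
  (G.induce X).Connected ∧ (G.around X).Balanced

/-- The graph obtained by adding a single `s`–`t` edge (with an arbitrary label). -/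
def addEdge (G : LGraph V Γ) (s t : V) (hs : s ∈ G.verts) (ht : t ∈ G.verts)
    (hst : s ≠ t) : LGraph V Γ where
  verts := G.verts
  arcs := insert (s, t, (1 : Γ)) G.arcs
  verts_finite := G.verts_finite
  arcs_finite := G.arcs_finite.insert _
  tail_mem := by
    intro a ha
    rcases Set.mem_insert_iff.mp ha with rfl | h
    · exact hs
    · exact G.tail_mem a h
  head_mem := by
    intro a ha
    rcases Set.mem_insert_iff.mp ha with rfl | h
    · exact ht
    · exact G.head_mem a h
  loopless := by
    intro a ha
    rcases Set.mem_insert_iff.mp ha with rfl | h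
    · exact hst
    · exact G.loopless a h

/-- 2-connectivity: more than 2 vertices, and removing any single vertex leaves
the graph connected. -/
def TwoConnected (G : LGraph V Γ) : Prop :=
  2 < G.verts.ncard ∧ ∀ v : V, (G.delete {v}).Connected

/-- The effect of shifting by `α` at `v` on a single arc. -/
def shiftArc (v : V) (α : Γ) (a : V × V × Γ) : V × V × Γ :=
  (a.1, a.2.1, if a.2.1 = v then α * a.2.2 else if a.1 = v then a.2.2 * α⁻¹ else a.2.2)

/-- The graph obtained from `G` by shifting by `α` at `v`. -/
def shift (G : LGraph V Γ) (v : V) (α : Γ) : LGraph V Γ where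
  verts := G.verts
  arcs := shiftArc v α '' G.arcs
  verts_finite := G.verts_finite
  arcs_finite := G.arcs_finite.image _
  tail_mem := by rintro a ⟨b, hb, rfl⟩; exact G.tail_mem b hb
  head_mem := by rintro a ⟨b, hb, rfl⟩; exact G.head_mem b hb
  loopless := by rintro a ⟨b, hb, rfl⟩; exact G.loopless b hb

/-- The walk in `G.shift v α` corresponding to a walk in `G`. -/
def Walk.shiftMap {G : LGraph V Γ} (v : V) (α : Γ) :
    {u w : V} → G.Walk u w → (G.shift v α).Walk u w
  | _, _, .nil x => .nil x
  | _, _, .cons u x a ha hstep W =>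
      .cons u x (shiftArc v α a) (Set.mem_image_of_mem _ ha) hstep (Walk.shiftMap v α W)

end LGraph

namespace LGraph

variable {V : Type} {Γ : Type} [Group Γ] [DecidableEq V]

theorem mul_stepLabel_eq {a : V × V × Γ} {u v : V} {φ : V → Γ} (hloop : a.1 ≠ a.2.1)
    (hconn : connects a u v) (hφ : φ a.2.1 * a.2.2 = φ a.1) :
    φ v * stepLabel v a = φ u := by
  rcases hconn with ⟨rfl, rfl⟩ | ⟨rfl, rfl⟩
  · simp [stepLabel, hφ]
  · simp [stepLabel, hloop.symm, ← hφ]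

namespace Walk

variable {G : LGraph V Γ}

theorem start_mem_support {u w : V} (W : G.Walk u w) : u ∈ W.support := by
  cases W <;> simp [support]

/-- If `φ` is a potential for the labels of the arcs inside `X`, then the label of a walk
inside `X` is determined by the potential of its ends. -/
theorem mul_label_eq {X : Set V} {φ : V → Γ}
    (hφ : ∀ a ∈ G.arcs, a.1 ∈ X → a.2.1 ∈ X → φ a.2.1 * a.2.2 = φ a.1)
    {u w : V} (W : G.Walk u w) (hW : ∀ v ∈ W.support, v ∈ X) :
    φ w * W.label = φ u := by
  induction W with
  | nil v => simp [label]
  | cons u v a ha hstep W ih =>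
    simp only [support, List.mem_cons, forall_eq_or_imp] at hW
    have hv := hW.2 v W.start_mem_support
    have hpot : φ a.2.1 * a.2.2 = φ a.1 := by
      rcases hstep with ⟨h₁, h₂⟩ | ⟨h₁, h₂⟩
      · exact hφ a ha (h₁ ▸ hW.1) (h₂ ▸ hv)
      · exact hφ a ha (h₁ ▸ hv) (h₂ ▸ hW.1)
    rw [label, ← mul_assoc, ih hW.2]
    exact mul_stepLabel_eq (G.loopless a ha) hstep hpot

/-- The part of a path after a vertex other than its start is a path avoiding the start. -/
theorem IsPath.exists_suffix {u v w : V} {W : G.Walk u w} (hW : W.IsPath)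
    (hv : v ∈ W.support) (hne : v ≠ u) :
    ∃ P : G.Walk v w, P.IsPath ∧ u ∉ P.support ∧ P.support ⊆ W.support := by
  induction W with
  | nil => simp [support, hne] at hv
  | cons u x a ha hstep W ih =>
    simp only [IsPath, support, List.nodup_cons] at hW
    have hvW : v ∈ W.support := by simpa [support, hne] using hv
    by_cases hx : v = x
    · subst hx
      exact ⟨W, hW.2, hW.1, List.subset_cons_self _ _⟩
    · obtain ⟨P, hP, -, hsub⟩ := ih hW.2 hvW hx
      exact ⟨P, hP, fun h => hW.1 (hsub h), fun y hy => List.mem_cons_of_mem _ (hsub hy)⟩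

end Walk

/-- A graph whose labels come from a potential is balanced. -/
theorem balanced_of_potential {G : LGraph V Γ} (φ : V → Γ)
    (hφ : ∀ a ∈ G.arcs, φ a.2.1 * a.2.2 = φ a.1) : G.Balanced := by
  intro v C _
  have h := C.mul_label_eq (X := Set.univ) (φ := φ) (fun a ha _ _ => hφ a ha) (by simp)
  simpa using h

/-- If all arcs at `s` leave `s`, the labels of the arcs avoiding `s` come from a potential `φ`,
and `φ t = 1`, then the `s`–`t` paths have exactly the labels of the shifted arcs at `s`. -/
theorem labelSet_eq_image {G : LGraph V Γ} {s t : V} {φ : V → Γ} (hst : s ≠ t)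
    (ht : φ t = 1) (hpath : ∀ v ∈ G.verts, ∃ P : G.Walk s t, P.IsPath ∧ v ∈ P.support)
    (hleave : ∀ a ∈ G.arcs, a.2.1 ≠ s)
    (hφ : ∀ a ∈ G.arcs, a.1 ≠ s → φ a.2.1 * a.2.2 = φ a.1) :
    labelSet G s t = (fun a : V × V × Γ => φ a.2.1 * a.2.2) '' {a ∈ G.arcs | a.1 = s} := by
  have key : ∀ {v : V} (W : G.Walk v t), s ∉ W.support → W.label = φ v := by
    intro v W hW
    have h := W.mul_label_eq (X := {s}ᶜ) (φ := φ) (fun a ha h _ => hφ a ha h)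
      (fun x hx hxs => hW (hxs ▸ hx))
    simpa [ht] using h
  ext γ
  constructor
  · rintro ⟨P, hP, rfl⟩
    cases P with
    | nil => exact absurd rfl hst
    | cons _ v a ha hstep W =>
      simp only [Walk.IsPath, Walk.support, List.nodup_cons] at hP
      rcases hstep with ⟨h₁, rfl⟩ | ⟨_, h₂⟩
      · exact ⟨a, ⟨ha, h₁⟩, by simp [Walk.label, stepLabel, key W hP.1]⟩
      · exact absurd h₂ (hleave a ha)
  · rintro ⟨a, ⟨ha, has⟩, rfl⟩
    obtain ⟨Q, hQ, hmem⟩ := hpath _ (G.head_mem a ha)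
    obtain ⟨P, hP, hsP, -⟩ := hQ.exists_suffix hmem (hleave a ha)
    refine ⟨.cons s a.2.1 a ha (Or.inl ⟨has, rfl⟩) P, ?_, ?_⟩
    · exact List.nodup_cons.mpr ⟨hsP, hP⟩
    · simp [Walk.label, stepLabel, key P hsP]

end LGraph

open LGraph in
/-- Let `α ≠ β`, `(G, s, t) ∈ 𝒟`, `G` not balanced, all arcs around
`s` leaving `s`, and `G` (s,t)-equivalent to a graph in which every arc incident to
`s` has label `α` or `β` and every other arc has label `1`.  Then
`l(G; s, t) = {α, β}`. -/
theorem caseA1_gives_two_labels {V Γ : Type} [Group Γ] [DecidableEq V]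
    (G : LGraph V Γ) (s t : V) (α β : Γ) (hne : α ≠ β)
    (hD : G.MemD s t) (hnb : ¬ G.Balanced)
    (hleave : ∀ a ∈ G.arcs, a.2.1 ≠ s)
    (G' : LGraph V Γ) (hEq : STEquiv s t G G')
    (hlab : ∀ a ∈ G'.arcs,
      ((a.1 = s ∨ a.2.1 = s) → a.2.2 ∈ ({α, β} : Set Γ)) ∧
      (¬ (a.1 = s ∨ a.2.1 = s) → a.2.2 = 1)) :
    labelSet G s t = {α, β} := by
  obtain ⟨hst, -, -, hpath, -⟩ := hD
  obtain ⟨φ, hs, ht, -, harcs⟩ := hEq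
  have hlab' : ∀ a ∈ G.arcs, (a.1 = s → φ a.2.1 * a.2.2 = α ∨ φ a.2.1 * a.2.2 = β) ∧
      (a.1 ≠ s → φ a.2.1 * a.2.2 = φ a.1) := by
    intro a ha
    have h := hlab _ (harcs ▸ Set.mem_image_of_mem _ ha)
    refine ⟨fun has => ?_, fun has => ?_⟩
    · simpa [has, hs] using h.1 (Or.inl has)
    · exact mul_inv_eq_one.mp (h.2 (by simp [has, hleave a ha]))
  -- Otherwise replacing `φ s` by `γ` turns `φ` into a potential for all of `G`.
  have hex : ∀ γ : Γ, ∃ a ∈ G.arcs, a.1 = s ∧ φ a.2.1 * a.2.2 ≠ γ := by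
    intro γ
    by_contra! hall
    refine hnb (balanced_of_potential (Function.update φ s γ) fun a ha => ?_)
    rw [Function.update_of_ne (hleave a ha)]
    by_cases has : a.1 = s
    · rw [has, Function.update_self, hall a ha has]
    · rw [Function.update_of_ne has, (hlab' a ha).2 has]
  rw [labelSet_eq_image hst ht hpath hleave fun a ha => (hlab' a ha).2]
  apply Set.Subset.antisymm
  · rintro _ ⟨a, ⟨ha, has⟩, rfl⟩
    exact (hlab' a ha).1 has
  · rintro γ (rfl | rfl)
    · obtain ⟨a, ha, has, hγ⟩ := hex β
      exact ⟨a, ⟨ha, has⟩, ((hlab' a ha).1 has).resolve_right hγ⟩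
    · obtain ⟨a, ha, has, hγ⟩ := hex α
      exact ⟨a, ⟨ha, has⟩, ((hlab' a ha).1 has).resolve_left hγ⟩
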